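/- Let (P, ≤) be a partially ordered set, and let A₂(P) = {(x,y) ∈ P × P : x ∥ y} be the set of ordered pairs of incomparable elements. Let ⪯_A be the reflexive-transitive closure, within A₂(P), of the relation (x,y) ≤_A (u,v) iff (x = u and y ≤ v) or (y = v and u ≤ x). Then for all (x,y), (u,v) ∈ A₂(P), (x,y) ⪯_A (u,v) holds if and only if (x,y) ⪯_E (u,v) holds in (P̃, ⪯_E); that is, (A₂(P), ⪯_A) is the induced subposet of (P̃, ⪯_E). -/

import Mathlib

/-- The set `P̃` of ordered pairs of distinct elements of `P`. -/
abbrev Pairs (P : Type*) := {p : P × P // p.1 ≠ p.2}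

/-- The set `A₂(P)` of ordered pairs of incomparable elements of `P`. -/
abbrev OrdAntichains (P : Type*) [PartialOrder P] :=
  {p : P × P // ¬p.1 ≤ p.2 ∧ ¬p.2 ≤ p.1}

/-- The relation `≤_E` on `P̃`: `(x,y) ≤_E (u,v)` iff (`x = u` and `y ≤ v`) or
(`y = v` and `u ≤ x`). -/
def leE {P : Type*} [PartialOrder P] (a b : Pairs P) : Prop :=
  (a.1.1 = b.1.1 ∧ a.1.2 ≤ b.1.2) ∨ (a.1.2 = b.1.2 ∧ b.1.1 ≤ a.1.1)

/-- The relation `≤_A` on `A₂(P)`, the restriction of `≤_E`. -/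
def leA {P : Type*} [PartialOrder P] (a b : OrdAntichains P) : Prop :=
  (a.1.1 = b.1.1 ∧ a.1.2 ≤ b.1.2) ∨ (a.1.2 = b.1.2 ∧ b.1.1 ≤ a.1.1)

/-- The inclusion `A₂(P) ⊆ P̃` (incomparable elements are distinct). -/
def incl {P : Type*} [PartialOrder P] (a : OrdAntichains P) : Pairs P :=
  ⟨a.1, fun h => a.2.1 (le_of_eq h)⟩

theorem leE.fst_ge_and_snd_le {P : Type*} [PartialOrder P] {a b : Pairs P} (h : leE a b) :
    b.1.1 ≤ a.1.1 ∧ a.1.2 ≤ b.1.2 := by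
  rcases h with ⟨h₁, h₂⟩ | ⟨h₁, h₂⟩
  · exact ⟨h₁.ge, h₂⟩
  · exact ⟨h₂, h₁.le⟩

theorem fst_ge_and_snd_le_of_reflTransGen_leE {P : Type*} [PartialOrder P] {a b : Pairs P}
    (h : Relation.ReflTransGen leE a b) : b.1.1 ≤ a.1.1 ∧ a.1.2 ≤ b.1.2 := by
  induction h with
  | refl => exact ⟨le_rfl, le_rfl⟩
  | tail _ hcd ih =>
    have hstep := hcd.fst_ge_and_snd_le
    exact ⟨hstep.1.trans ih.1, ih.2.trans hstep.2⟩

/-- A `⪯_E`-chain between incomparable pairs stays among incomparable pairs. -/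
theorem reflTransGen_leA_of_reflTransGen_leE {P : Type*} [PartialOrder P] (a : OrdAntichains P)
    {c : Pairs P} (h : Relation.ReflTransGen leE (incl a) c)
    (hc : ¬c.1.1 ≤ c.1.2 ∧ ¬c.1.2 ≤ c.1.1) :
    Relation.ReflTransGen leA a ⟨c.1, hc⟩ := by
  induction h with
  | refl => exact .refl
  | @tail c d hac hcd ih =>
    have hstep := hcd.fst_ge_and_snd_le
    have hpath := fst_ge_and_snd_le_of_reflTransGen_leE hac
    exact (ih ⟨fun h => hc.1 (hstep.1.trans (h.trans hstep.2)),
      fun h => a.2.2 (hpath.2.trans (h.trans hpath.1))⟩).tail hcd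

/-- `(A₂(P), ⪯_A)` is the induced subposet of `(P̃, ⪯_E)`: for ordered pairs of
incomparable elements, `(x,y) ⪯_A (u,v)` iff `(x,y) ⪯_E (u,v)`. -/
theorem stmt_8 {P : Type*} [PartialOrder P] (a b : OrdAntichains P) :
    Relation.ReflTransGen leA a b ↔
      Relation.ReflTransGen leE (incl a) (incl b) :=
  ⟨fun h => h.lift incl fun _ _ hab => hab,
    fun h => reflTransGen_leA_of_reflTransGen_leE a h b.2⟩
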